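/- Let n ≥ 1, let -∞ ≤ a < b ≤ +∞, fix c ∈ (a,b), and let B0, B1 : (a,b) → ℂ^{2n×2n} be measurable and locally integrable with B0(x) and B1(x) Hermitian and B1(x) positive semidefinite for a.e. x ∈ (a,b). Fix λ ∈ ℂ with Im λ ≠ 0, and suppose Φ : (a,b) → ℂ^{2n×2n} is locally absolutely continuous with J Φ'(x) = (B0(x) + λ B1(x)) Φ(x) for a.e. x ∈ (a,b), Φ(c) = I_{2n}, and Φ(x) invertible for every x ∈ (a,b); assume the Atkinson condition: for every nonzero w ∈ ℂ^{2n} and every compact subinterval [c',d'] ⊂ (a,b) with c' < d', ∫_{c'}^{d'} (B1(x) Φ(x)w, Φ(x)w) dx > 0. Define A(x) := (1/(2 Im λ)) Φ(x)* (J/i) Φ(x), and for each x let μ₁(x) ≤ μ₂(x) ≤ … ≤ μ_{2n}(x) be the eigenvalues of the Hermitian matrix A(x) listed in nondecreasing order with multiplicity. Then the set W := { w ∈ ℂ^{2n} : the function x ↦ (B1(x) Φ(x)w, Φ(x)w) is integrable on (c,b) } is a ℂ-linear subspace of ℂ^{2n}, and dim_ℂ W equals the number of indices j ∈ {1,…,2n}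 for which μ_j(x) converges to a finite real limit as x → b⁻. -/

import Mathlib

open Matrix Set Filter Topology MeasureTheory Polynomial
open scoped ComplexOrder

noncomputable section

/-- The standard `2n × 2n` complex symplectic matrix `J = [[0, -I],[I, 0]]`. -/
def stdJ (n : ℕ) : Matrix (Fin n ⊕ Fin n) (Fin n ⊕ Fin n) ℂ :=
  Matrix.fromBlocks 0 (-1) 1 0

/-- The Hermitian matrix `J/i = -iJ`. -/
def stdJi (n : ℕ) : Matrix (Fin n ⊕ Fin n) (Fin n ⊕ Fin n) ℂ :=
  (-Complex.I) • stdJ n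

/-- Niessen's matrix `A(x;λ) = (1/(2 Im λ)) Φ(x)* (J/i) Φ(x)`. -/
def calA (n : ℕ) (lam : ℂ) (Φ : ℝ → Matrix (Fin n ⊕ Fin n) (Fin n ⊕ Fin n) ℂ)
    (x : ℝ) : Matrix (Fin n ⊕ Fin n) (Fin n ⊕ Fin n) ℂ :=
  (1 / (2 * (lam.im : ℂ))) • ((Φ x)ᴴ * stdJi n * Φ x)

lemma exists_equiv_of_map_univ_eq {α β γ : Type*} [Fintype α] [Fintype β] [DecidableEq γ]
    {f : α → γ} {g : β → γ}
    (h : Finset.univ.val.map f = Finset.univ.val.map g) : ∃ e : α ≃ β, ∀ x, g (e x) = f x := by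
  have hcard : ∀ c, Fintype.card {x // f x = c} = Fintype.card {y // g y = c} := by
    intro c
    have h' := congrArg (Multiset.count c) h
    rw [Multiset.count_map, Multiset.count_map] at h'
    rw [Fintype.card_subtype, Fintype.card_subtype]
    simpa [Finset.card, Finset.filter, eq_comm] using h'
  exact ⟨Equiv.ofFiberEquiv fun c => Fintype.equivOfCardEq (hcard c),
    fun x => Equiv.ofFiberEquiv_map _ x⟩

section HermitianForm

variable {ι : Type*} [Fintype ι]

/-- The real part of the sesquilinear form `v ↦ v* A v` on the diagonal. -/
def reForm (A : Matrix ι ι ℂ) (v : ι → ℂ) : ℝ := (star v ⬝ᵥ A *ᵥ v).re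

/-- The squared Euclidean norm on `ι → ℂ`. -/
def sqNorm (v : ι → ℂ) : ℝ := ∑ i, Complex.normSq (v i)

lemma sqNorm_eq_re_dotProduct (v : ι → ℂ) : sqNorm v = (star v ⬝ᵥ v).re := by
  simp [sqNorm, dotProduct, Complex.normSq_apply]

lemma normSq_apply_le_sqNorm (v : ι → ℂ) (i : ι) : Complex.normSq (v i) ≤ sqNorm v :=
  Finset.single_le_sum (f := fun i => Complex.normSq (v i))
    (fun _ _ => Complex.normSq_nonneg _) (Finset.mem_univ i)

lemma sqNorm_pos {v : ι → ℂ} (hv : v ≠ 0) : 0 < sqNorm v := by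
  obtain ⟨i, hi⟩ := Function.ne_iff.1 hv
  exact (Complex.normSq_pos.2 hi).trans_le (normSq_apply_le_sqNorm v i)

lemma sqNorm_smul (a : ℂ) (v : ι → ℂ) : sqNorm (a • v) = Complex.normSq a * sqNorm v := by
  simp [sqNorm, Finset.mul_sum]

lemma reForm_smul (A : Matrix ι ι ℂ) (a : ℂ) (v : ι → ℂ) :
    reForm A (a • v) = Complex.normSq a * reForm A v := by
  have : star (a • v) ⬝ᵥ A *ᵥ (a • v) = (Complex.normSq a : ℂ) * (star v ⬝ᵥ A *ᵥ v) := by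
    rw [star_smul, mulVec_smul, smul_dotProduct, dotProduct_smul, smul_eq_mul, smul_eq_mul,
      ← mul_assoc, Complex.normSq_eq_conj_mul_self]
    rfl
  rw [reForm, this, Complex.re_ofReal_mul, reForm]

lemma reForm_add_add_reForm_sub (A : Matrix ι ι ℂ) (v w : ι → ℂ) :
    reForm A (v + w) + reForm A (v - w) = 2 * reForm A v + 2 * reForm A w := by
  simp only [reForm, star_add, star_sub, mulVec_add, mulVec_sub, add_dotProduct, sub_dotProduct,
    dotProduct_add, dotProduct_sub, Complex.add_re, Complex.sub_re]
  ring

lemma continuous_reForm (A : Matrix ι ι ℂ) : Continuous (reForm A) := by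
  unfold reForm
  fun_prop

lemma continuous_sqNorm : Continuous (sqNorm : (ι → ℂ) → ℝ) :=
  continuous_finsetSum _ fun i _ => Complex.continuous_normSq.comp (continuous_apply i)

lemma isCompact_sqNorm_eq_one : IsCompact {v : ι → ℂ | sqNorm v = 1} := by
  refine Metric.isCompact_of_isClosed_isBounded (isClosed_eq continuous_sqNorm continuous_const) ?_
  refine (Metric.isBounded_closedBall (x := (0 : ι → ℂ)) (r := 1)).subset fun v hv => ?_
  rw [mem_closedBall_zero_iff, pi_norm_le_iff_of_nonneg zero_le_one]
  intro i
  have h := normSq_apply_le_sqNorm v i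
  rw [Complex.normSq_eq_norm_sq, hv] at h
  exact (sq_le_one_iff₀ (norm_nonneg _)).1 h

variable [DecidableEq ι]

lemma exists_diagonalizing_equiv {N : ℕ} {A : Matrix ι ι ℂ} (hA : A.IsHermitian) {μ : Fin N → ℝ}
    (hμ : A.charpoly = ∏ j, (X - C ((μ j : ℝ) : ℂ))) :
    ∃ T : (ι → ℂ) ≃ₗ[ℂ] (Fin N → ℂ), ∀ v,
      reForm A v = ∑ j, μ j * Complex.normSq (T v j) ∧ sqNorm v = sqNorm (T v) := by
  have hroots : Finset.univ.val.map (fun j => (μ j : ℂ)) =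
      Finset.univ.val.map (fun i => (hA.eigenvalues i : ℂ)) := by
    have h := hA.roots_charpoly_eq_eigenvalues
    rw [hμ, Polynomial.roots_prod _ _ (Finset.prod_ne_zero_iff.2 fun j _ => X_sub_C_ne_zero _)] at h
    simpa using h
  obtain ⟨e, he⟩ := exists_equiv_of_map_univ_eq hroots
  replace he : ∀ j, hA.eigenvalues (e j) = μ j := fun j => by exact_mod_cast he j
  set U : Matrix ι ι ℂ := (hA.eigenvectorUnitary : Matrix ι ι ℂ) with hU
  have hUU : star U * U = 1 := Unitary.coe_star_mul_self _
  have hUU' : U * star U = 1 := Unitary.coe_mul_star_self _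
  have hspec : A = U * diagonal (fun i => (hA.eigenvalues i : ℂ)) * star U := by
    conv_lhs => rw [hA.spectral_theorem, Unitary.conjStarAlgAut_apply]
    rfl
  let T₀ : (ι → ℂ) ≃ₗ[ℂ] (ι → ℂ) := LinearEquiv.ofLinearMap (toLin' (star U)) (toLin' U)
    (by rw [← toLin'_mul, hUU, toLin'_one]) (by rw [← toLin'_mul, hUU', toLin'_one])
  have hT₀ : ∀ v, T₀ v = star U *ᵥ v := fun v => rfl
  have hstar : ∀ v, star (T₀ v) = star v ᵥ* U := fun v => by
    rw [hT₀, star_mulVec, star_eq_conjTranspose, conjTranspose_conjTranspose]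
  refine ⟨T₀.trans (LinearEquiv.funCongrLeft ℂ ℂ e), fun v => ⟨?_, ?_⟩⟩
  · have h1 : star v ⬝ᵥ A *ᵥ v =
        star (T₀ v) ⬝ᵥ diagonal (fun i => (hA.eigenvalues i : ℂ)) *ᵥ (T₀ v) := by
      rw [hstar, hT₀, ← dotProduct_mulVec, mulVec_mulVec, mulVec_mulVec, ← hspec]
    have h2 : reForm A v = ∑ i, hA.eigenvalues i * Complex.normSq (T₀ v i) := by
      rw [reForm, h1]
      simp only [dotProduct, mulVec_diagonal, Pi.star_apply, Complex.re_sum]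
      refine Finset.sum_congr rfl fun i _ => ?_
      simp [Complex.normSq_apply]
      ring
    rw [h2, ← e.sum_comp]
    simp [he, LinearEquiv.funCongrLeft, LinearMap.funLeft]
  · have h1 : sqNorm v = sqNorm (T₀ v) := by
      rw [sqNorm_eq_re_dotProduct, sqNorm_eq_re_dotProduct, hstar, hT₀, ← dotProduct_mulVec,
        mulVec_mulVec, hUU', one_mulVec]
    rw [h1, sqNorm, sqNorm, ← e.sum_comp]
    simp [LinearEquiv.funCongrLeft, LinearMap.funLeft]

lemma exists_reForm_le_mul_sqNorm {N : ℕ} {A : Matrix ι ι ℂ} (hA : A.IsHermitian) {μ : Fin N → ℝ}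
    (hμ : A.charpoly = ∏ j, (X - C ((μ j : ℝ) : ℂ))) :
    ∃ C, ∀ v, reForm A v ≤ C * sqNorm v := by
  obtain ⟨T, hT⟩ := exists_diagonalizing_equiv hA hμ
  refine ⟨∑ j, |μ j|, fun v => ?_⟩
  rw [(hT v).1, (hT v).2, Finset.sum_mul]
  refine Finset.sum_le_sum fun j _ => ?_
  exact mul_le_mul (le_abs_self _) (normSq_apply_le_sqNorm _ _) (Complex.normSq_nonneg _)
    (abs_nonneg _)

/-- The Courant–Fischer characterization of the ordered eigenvalues of a Hermitian matrix. -/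
lemma eigenvalue_le_iff_exists_submodule {N : ℕ} {A : Matrix ι ι ℂ} (hA : A.IsHermitian)
    {μ : Fin N → ℝ} (hmono : Monotone μ)
    (hμ : A.charpoly = ∏ j, (X - C ((μ j : ℝ) : ℂ))) (j : Fin N) (C : ℝ) :
    μ j ≤ C ↔ ∃ V : Submodule ℂ (ι → ℂ), (j : ℕ) < Module.finrank ℂ V ∧
      ∀ v ∈ V, reForm A v ≤ C * sqNorm v := by
  obtain ⟨T, hT⟩ := exists_diagonalizing_equiv hA hμ
  have hspan : ∀ s : Set (Fin N), ∃ V : Submodule ℂ (ι → ℂ), Module.finrank ℂ V = s.ncard ∧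
      ∀ v ∈ V, ∀ i ∉ s, T v i = 0 := by
    intro s
    have hli : LinearIndependent ℂ fun i : s => T.symm (Pi.single (i : Fin N) 1) := by
      have := (((Pi.basisFun ℂ (Fin N)).map T.symm).linearIndependent).comp
        ((↑) : s → Fin N) Subtype.val_injective
      simpa [Function.comp_def] using this
    refine ⟨Submodule.span ℂ (Set.range fun i : s => T.symm (Pi.single (i : Fin N) 1)), ?_, ?_⟩
    · classical
      rw [finrank_span_eq_card hli, ← Nat.card_coe_set_eq, Nat.card_eq_fintype_card]
    · intro v hv i hi
      induction hv using Submodule.span_induction with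
      | mem x hx =>
        obtain ⟨k, rfl⟩ := hx
        have : i ≠ k := fun h => hi (h ▸ k.2)
        simp [this]
      | zero => simp
      | add x y _ _ hx hy => simp [hx, hy]
      | smul a x _ hx => simp [hx]
  constructor
  · intro hj
    obtain ⟨V, hV, hV'⟩ := hspan (Set.Iic j)
    refine ⟨V, ?_, fun v hv => ?_⟩
    · rw [hV, Set.ncard_eq_toFinset_card']
      simp
    · rw [(hT v).1, (hT v).2, sqNorm, Finset.mul_sum]
      refine Finset.sum_le_sum fun i _ => ?_
      by_cases hi : i ≤ j
      · exact mul_le_mul_of_nonneg_right ((hmono hi).trans hj) (Complex.normSq_nonneg _)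
      · simp [hV' v hv i (by simpa using hi)]
  · rintro ⟨V, hV, hVC⟩
    obtain ⟨U, hU, hU'⟩ := hspan (Set.Ici j)
    have hN : Module.finrank ℂ (ι → ℂ) = N := by simpa using T.finrank_eq
    have hUcard : Module.finrank ℂ U = N - j := by
      rw [hU, Set.ncard_eq_toFinset_card']
      simp
    have hdisj : ¬ Disjoint V U := fun h => by
      have := Submodule.finrank_add_finrank_le_of_disjoint h
      omega
    obtain ⟨v, hvV, hvU, hv0⟩ : ∃ v ∈ V, v ∈ U ∧ v ≠ 0 := by
      rw [Submodule.disjoint_def] at hdisj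
      push Not at hdisj
      exact hdisj
    have h1 : μ j * sqNorm v ≤ reForm A v := by
      rw [(hT v).1, (hT v).2, sqNorm, Finset.mul_sum]
      refine Finset.sum_le_sum fun i _ => ?_
      by_cases hi : j ≤ i
      · exact mul_le_mul_of_nonneg_right (hmono hi) (Complex.normSq_nonneg _)
      · simp [hU' v hvU i (by simpa using hi)]
    exact le_of_mul_le_mul_right (h1.trans (hVC v hvV)) (sqNorm_pos hv0)

end HermitianForm

lemma monotone_eigenvalue {τ : Type*} [Preorder τ] {ι : Type*} [Fintype ι] [DecidableEq ι]
    {A : τ → Matrix ι ι ℂ} (hA : ∀ v, Monotone fun x => reForm (A x) v)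
    (hherm : ∀ x, (A x).IsHermitian) {N : ℕ} {μ : τ → Fin N → ℝ}
    (hchar : ∀ x, (A x).charpoly = ∏ j, (X - C ((μ x j : ℝ) : ℂ)))
    (hmono : ∀ x, Monotone (μ x)) (j : Fin N) : Monotone fun x => μ x j := by
  intro x y hxy
  obtain ⟨V, hV, hV'⟩ :=
    (eigenvalue_le_iff_exists_submodule (hherm y) (hmono y) (hchar y) j _).1 le_rfl
  exact (eigenvalue_le_iff_exists_submodule (hherm x) (hmono x) (hchar x) j _).2
    ⟨V, hV, fun v hv => (hA v hxy).trans (hV' v hv)⟩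

section MonotoneFamily

variable {τ : Type*} [LinearOrder τ] {ι : Type*} [Fintype ι]

/-- The subspace on which a nondecreasing family of Hermitian forms stays bounded. -/
def boundedSubspace [OrderBot τ] (A : τ → Matrix ι ι ℂ)
    (hA : ∀ v, Monotone fun x => reForm (A x) v) : Submodule ℂ (ι → ℂ) where
  carrier := {v | ∃ C, ∀ x, reForm (A x) v ≤ C}
  zero_mem' := ⟨0, fun x => by simp [reForm]⟩
  smul_mem' := by
    rintro a v ⟨C, hC⟩
    refine ⟨Complex.normSq a * C, fun x => ?_⟩
    rw [reForm_smul]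
    exact mul_le_mul_of_nonneg_left (hC x) (Complex.normSq_nonneg _)
  add_mem' := by
    rintro v w ⟨C, hC⟩ ⟨D, hD⟩
    refine ⟨2 * C + 2 * D - reForm (A ⊥) (v - w), fun x => ?_⟩
    have h1 := reForm_add_add_reForm_sub (A x) v w
    have h2 := hA (v - w) (bot_le : ⊥ ≤ x)
    linarith [hC x, hD x]

variable [OrderBot τ] {A : τ → Matrix ι ι ℂ} (hA : ∀ v, Monotone fun x => reForm (A x) v)
include hA

lemma mem_boundedSubspace {v : ι → ℂ} :
    v ∈ boundedSubspace A hA ↔ ∃ C, ∀ x, reForm (A x) v ≤ C := Iff.rfl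

lemma reForm_sub_bot_sum_le {κ : Type*} (s : Finset κ) (f : κ → ι → ℂ) (x : τ) :
    reForm (A x) (∑ i ∈ s, f i) - reForm (A ⊥) (∑ i ∈ s, f i) ≤
      2 ^ s.card * ∑ i ∈ s, (reForm (A x) (f i) - reForm (A ⊥) (f i)) := by
  classical
  have hpos : ∀ v, 0 ≤ reForm (A x) v - reForm (A ⊥) v := fun v =>
    sub_nonneg.2 (hA v bot_le)
  induction s using Finset.induction_on with
  | empty => simp [reForm]
  | insert i s hi ih =>
    rw [Finset.sum_insert hi, Finset.sum_insert hi, Finset.card_insert_of_notMem hi, pow_succ]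
    have h1 := reForm_add_add_reForm_sub (A x) (f i) (∑ i ∈ s, f i)
    have h2 := reForm_add_add_reForm_sub (A ⊥) (f i) (∑ i ∈ s, f i)
    have h3 := hpos (f i - ∑ i ∈ s, f i)
    have h4 : reForm (A x) (f i) - reForm (A ⊥) (f i) ≤
        2 ^ s.card * (reForm (A x) (f i) - reForm (A ⊥) (f i)) :=
      le_mul_of_one_le_left (hpos _) (one_le_pow₀ one_le_two)
    linarith

variable [DecidableEq ι] {N : ℕ} (hherm : ∀ x, (A x).IsHermitian) {μ : τ → Fin N → ℝ}
  (hchar : ∀ x, (A x).charpoly = ∏ j, (X - C ((μ x j : ℝ) : ℂ)))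
include hherm hchar

lemma exists_forall_reForm_le_of_mem_boundedSubspace :
    ∃ C, ∀ v ∈ boundedSubspace A hA, ∀ x, reForm (A x) v ≤ C * sqNorm v := by
  obtain ⟨C₀, hC₀⟩ := exists_reForm_le_mul_sqNorm (hherm ⊥) (hchar ⊥)
  obtain ⟨π, hπ⟩ := LinearMap.exists_leftInverse_of_injective (boundedSubspace A hA).subtype
    (Submodule.ker_subtype _)
  choose D hD using fun i : ι => (mem_boundedSubspace hA).1 (π (Pi.single i 1)).2
  refine ⟨2 ^ Fintype.card ι *
    ∑ i, (D i - reForm (A ⊥) (π (Pi.single i 1) : ι → ℂ)) + C₀, fun v hv x => ?_⟩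
  have hv' : v = ∑ i, v i • (π (Pi.single i 1) : ι → ℂ) := by
    have h1 : (π v : ι → ℂ) = v :=
      congrArg Subtype.val (LinearMap.congr_fun hπ (⟨v, hv⟩ : boundedSubspace A hA))
    conv_lhs => rw [← h1, pi_eq_sum_univ' v]
    simp [map_sum]
  have h1 := reForm_sub_bot_sum_le hA Finset.univ
    (fun i => v i • (π (Pi.single i 1) : ι → ℂ)) x
  rw [← hv', Finset.card_univ] at h1
  have h2 : ∑ i, (reForm (A x) (v i • (π (Pi.single i 1) : ι → ℂ)) -
        reForm (A ⊥) (v i • (π (Pi.single i 1) : ι → ℂ))) ≤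
      (∑ i, (D i - reForm (A ⊥) (π (Pi.single i 1) : ι → ℂ))) * sqNorm v := by
    rw [Finset.sum_mul]
    refine Finset.sum_le_sum fun i _ => ?_
    rw [reForm_smul, reForm_smul, ← mul_sub, mul_comm]
    have h3 : reForm (A ⊥) (π (Pi.single i 1) : ι → ℂ) ≤ reForm (A x) (π (Pi.single i 1)) :=
      hA _ bot_le
    exact mul_le_mul (by linarith [hD i x]) (normSq_apply_le_sqNorm v i)
      (Complex.normSq_nonneg _) (by linarith [hD i x])
  have h4 := mul_le_mul_of_nonneg_left h2 (pow_nonneg zero_le_two (Fintype.card ι) : (0:ℝ) ≤ _)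
  linarith [hC₀ v]

variable (hmono : ∀ x, Monotone (μ x))
include hmono

lemma eigenvalue_bounded_iff (j : Fin N) :
    (∃ C, ∀ x, μ x j ≤ C) ↔ (j : ℕ) < Module.finrank ℂ (boundedSubspace A hA) := by
  constructor
  · rintro ⟨C, hC⟩
    by_contra! hj
    obtain ⟨U, hU⟩ := Submodule.exists_isCompl (boundedSubspace A hA)
    have hdim := Submodule.finrank_add_eq_of_isCompl hU
    let K : τ → Set (ι → ℂ) := fun x =>
      ({v | sqNorm v = 1} ∩ (U : Set (ι → ℂ))) ∩ {v | reForm (A x) v ≤ C}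
    have hclosed : ∀ x, IsClosed (K x) := fun x =>
      (isCompact_sqNorm_eq_one.isClosed.inter U.closed_of_finiteDimensional).inter
        (isClosed_le (continuous_reForm _) continuous_const)
    have hcompact : ∀ x, IsCompact (K x) := fun x =>
      isCompact_sqNorm_eq_one.of_isClosed_subset (hclosed x) fun v hv => hv.1.1
    have hne : ∀ x, (K x).Nonempty := by
      intro x
      obtain ⟨V, hV, hVC⟩ := (eigenvalue_le_iff_exists_submodule (hherm x) (hmono x) (hchar x) j
        C).1 (hC x)
      have hdisj : ¬ Disjoint V U := fun h => by
        have := Submodule.finrank_add_finrank_le_of_disjoint h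
        omega
      obtain ⟨v, hvV, hvU, hv0⟩ : ∃ v ∈ V, v ∈ U ∧ v ≠ 0 := by
        rw [Submodule.disjoint_def] at hdisj
        push Not at hdisj
        exact hdisj
      have hpos := sqNorm_pos hv0
      set a : ℂ := (((√(sqNorm v))⁻¹ : ℝ) : ℂ)
      have hnorm : sqNorm (a • v) = 1 := by
        rw [sqNorm_smul, Complex.normSq_ofReal, ← mul_inv, Real.mul_self_sqrt hpos.le,
          inv_mul_cancel₀ hpos.ne']
      refine ⟨a • v, ⟨hnorm, U.smul_mem a hvU⟩, ?_⟩
      simpa [hnorm] using hVC (a • v) (V.smul_mem a hvV)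
    have hdir : Directed (· ⊇ ·) K :=
      Antitone.directed_ge fun x y hxy v hv => ⟨hv.1, (hA v hxy).trans hv.2⟩
    obtain ⟨v, hv⟩ := IsCompact.nonempty_iInter_of_directed_nonempty_isCompact_isClosed K hdir hne
      hcompact hclosed
    rw [Set.mem_iInter] at hv
    have hvW : v ∈ boundedSubspace A hA := ⟨C, fun x => (hv x).2⟩
    have hv0 : v = 0 := Submodule.disjoint_def.1 hU.disjoint v hvW (hv ⊥).1.2
    have h1 : sqNorm v = 1 := (hv ⊥).1.1
    simp [hv0, sqNorm] at h1
  · intro hj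
    obtain ⟨C, hC⟩ := exists_forall_reForm_le_of_mem_boundedSubspace hA hherm hchar
    exact ⟨C, fun x => (eigenvalue_le_iff_exists_submodule (hherm x) (hmono x) (hchar x) j C).2
      ⟨_, hj, fun v hv => hC v hv x⟩⟩

lemma card_bounded_eigenvalues (hN : N = Fintype.card ι) :
    Nat.card {j : Fin N // ∃ C, ∀ x, μ x j ≤ C} =
      Module.finrank ℂ (boundedSubspace A hA) := by
  have hle : Module.finrank ℂ (boundedSubspace A hA) ≤ N := by
    simpa [hN] using (boundedSubspace A hA).finrank_le
  simp_rw [eigenvalue_bounded_iff hA hherm hchar hmono]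
  rw [Nat.card_eq_fintype_card, Fintype.card_subtype, Fin.card_filter_val_lt, min_eq_right hle]

end MonotoneFamily

section Primitive

/-- `f` is absolutely continuous on `[c, d]` with almost everywhere derivative `f'`. -/
def IsPrimitiveOn (f f' : ℝ → ℂ) (c d : ℝ) : Prop :=
  IntervalIntegrable f' volume c d ∧ ∀ x ∈ Icc c d, f x = f c + ∫ t in c..x, f' t

lemma AbsolutelyContinuousOnInterval.congr_of_eqOn {X : Type*} [PseudoMetricSpace X] {f g : ℝ → X}
    {c d : ℝ} (hf : AbsolutelyContinuousOnInterval f c d) (h : EqOn f g (uIcc c d)) :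
    AbsolutelyContinuousOnInterval g c d := by
  refine Tendsto.congr' (eventually_inf_principal.2 (Eventually.of_forall fun E hE => ?_)) hf
  exact Finset.sum_congr rfl fun i hi => by rw [h (hE.1 i hi).1, h (hE.1 i hi).2]

lemma absolutelyContinuousOnInterval_ofReal {u : ℝ → ℝ} {c d : ℝ}
    (h : AbsolutelyContinuousOnInterval u c d) :
    AbsolutelyContinuousOnInterval (fun x => (u x : ℂ)) c d := by
  unfold AbsolutelyContinuousOnInterval at h ⊢
  simpa only [Complex.isometry_ofReal.dist_eq] using h

lemma absolutelyContinuousOnInterval_intervalIntegral_complex {f : ℝ → ℂ} {c d e : ℝ}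
    (h : IntervalIntegrable f volume c d) (he : e ∈ uIcc c d) :
    AbsolutelyContinuousOnInterval (fun x => ∫ t in e..x, f t) c d := by
  have hre : IntervalIntegrable (fun t => (f t).re) volume c d := ⟨h.1.re, h.2.re⟩
  have him : IntervalIntegrable (fun t => (f t).im) volume c d := ⟨h.1.im, h.2.im⟩
  have h1 := absolutelyContinuousOnInterval_ofReal
    (hre.absolutelyContinuousOnInterval_intervalIntegral he)
  have h2 := absolutelyContinuousOnInterval_ofReal
    (him.absolutelyContinuousOnInterval_intervalIntegral he)
  refine (h1.fun_add (h2.const_smul Complex.I)).congr_of_eqOn fun x hx => ?_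
  have hx' : IntervalIntegrable f volume e x := h.mono_set (uIcc_subset_uIcc he hx)
  have hre' : IntervalIntegrable (fun t => (f t).re) volume e x := ⟨hx'.1.re, hx'.2.re⟩
  have him' : IntervalIntegrable (fun t => (f t).im) volume e x := ⟨hx'.1.im, hx'.2.im⟩
  simp only [← intervalIntegral.integral_ofReal]
  rw [← intervalIntegral.integral_smul, ← intervalIntegral.integral_add]
  · refine intervalIntegral.integral_congr fun t _ => ?_
    simp only [smul_eq_mul]
    rw [mul_comm, Complex.re_add_im]
  · exact ⟨hre'.1.ofReal, hre'.2.ofReal⟩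
  · exact IntervalIntegrable.const_mul ⟨him'.1.ofReal, him'.2.ofReal⟩ Complex.I

variable {f f' g g' : ℝ → ℂ} {c d : ℝ}

namespace IsPrimitiveOn

lemma of_absolutelyContinuous (hf : AbsolutelyContinuousOnInterval f c d)
    (hf' : IntervalIntegrable f' volume c d)
    (h : ∀ᵐ x, x ∈ uIcc c d → HasDerivAt f (f' x) x) (hcd : c ≤ d) : IsPrimitiveOn f f' c d := by
  refine ⟨hf', fun x hx => ?_⟩
  have hc : c ∈ uIcc c d := left_mem_uIcc
  have hac := hf.fun_sub (absolutelyContinuousOnInterval_intervalIntegral_complex hf' hc)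
  obtain ⟨C, hC⟩ := hac.const_of_ae_hasDerivAt_zero (by
    filter_upwards [h, hf'.ae_hasDerivAt_integral] with x hx₁ hx₂ hx
    simpa using (hx₁ hx).fun_sub (hx₂ hx c hc))
  have h1 := hC c hc
  have h2 := hC x (by rwa [uIcc_of_le hcd])
  simp only [intervalIntegral.integral_same, sub_zero] at h1
  rw [h1, ← h2]
  ring

lemma mono (h : IsPrimitiveOn f f' c d) {x : ℝ} (hx : x ∈ Icc c d) : IsPrimitiveOn f f' c x :=
  ⟨h.1.mono_set (by
    rw [uIcc_of_le hx.1, uIcc_of_le (hx.1.trans hx.2)]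
    exact Icc_subset_Icc_right hx.2), fun y hy => h.2 y ⟨hy.1, hy.2.trans hx.2⟩⟩

lemma sub_eq (h : IsPrimitiveOn f f' c d) {x y : ℝ} (hx : x ∈ Icc c d) (hy : y ∈ Icc c d) :
    f y - f x = ∫ t in x..y, f' t := by
  rw [h.2 x hx, h.2 y hy, add_sub_add_left_eq_sub,
    intervalIntegral.integral_interval_sub_left (h.mono hy).1 (h.mono hx).1]

lemma congr_ae (h : IsPrimitiveOn f f' c d) (hcd : c ≤ d)
    (hfg : ∀ᵐ x, x ∈ Ioc c d → f' x = g' x) : IsPrimitiveOn f g' c d := by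
  refine ⟨h.1.congr_ae ?_, fun x hx => ?_⟩
  · rw [uIoc_of_le hcd]
    exact (ae_restrict_iff' measurableSet_Ioc).2 hfg
  · rw [h.2 x hx, intervalIntegral.integral_congr_ae]
    filter_upwards [hfg] with t ht htx
    rw [uIoc_of_le hx.1] at htx
    exact ht ⟨htx.1, htx.2.trans hx.2⟩

lemma const_mul (h : IsPrimitiveOn f f' c d) (k : ℂ) :
    IsPrimitiveOn (fun x => k * f x) (fun x => k * f' x) c d :=
  ⟨h.1.const_mul k, fun x hx => by
    simp only [h.2 x hx, intervalIntegral.integral_const_mul, mul_add]⟩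

lemma star (h : IsPrimitiveOn f f' c d) :
    IsPrimitiveOn (fun x => star (f x)) (fun x => star (f' x)) c d := by
  refine ⟨⟨?_, ?_⟩, fun x hx => ?_⟩
  · exact (Complex.conjLIE.toContinuousLinearEquiv.toContinuousLinearMap).integrable_comp h.1.1
  · exact (Complex.conjLIE.toContinuousLinearEquiv.toContinuousLinearMap).integrable_comp h.1.2
  · simp only [h.2 x hx, star_add]
    exact congrArg _ intervalIntegral.intervalIntegral_conj.symm

lemma sum {κ : Type*} {s : Finset κ} {f f' : κ → ℝ → ℂ}
    (h : ∀ i ∈ s, IsPrimitiveOn (f i) (f' i) c d) :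
    IsPrimitiveOn (fun x => ∑ i ∈ s, f i x) (fun x => ∑ i ∈ s, f' i x) c d := by
  refine ⟨?_, fun x hx => ?_⟩
  · simpa [Finset.sum_fn] using IntervalIntegrable.sum s fun i hi => (h i hi).1
  · rw [intervalIntegral.integral_finsetSum fun i hi => ((h i hi).mono hx).1,
      ← Finset.sum_add_distrib]
    exact Finset.sum_congr rfl fun i hi => (h i hi).2 x hx

lemma mul (hf : IsPrimitiveOn f f' c d) (hg : IsPrimitiveOn g g' c d) (hcd : c ≤ d) :
    IsPrimitiveOn (fun x => f x * g x) (fun x => f' x * g x + f x * g' x) c d := by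
  have hc : c ∈ uIcc c d := left_mem_uIcc
  let F : ℝ → ℂ := fun x => f c + ∫ t in c..x, f' t
  let G : ℝ → ℂ := fun x => g c + ∫ t in c..x, g' t
  have hconst : ∀ z : ℂ, AbsolutelyContinuousOnInterval (fun _ : ℝ => z) c d := fun z => by
    simpa [AbsolutelyContinuousOnInterval] using tendsto_const_nhds
  have hF : AbsolutelyContinuousOnInterval F c d :=
    (hconst _).fun_add (absolutelyContinuousOnInterval_intervalIntegral_complex hf.1 hc)
  have hG : AbsolutelyContinuousOnInterval G c d :=
    (hconst _).fun_add (absolutelyContinuousOnInterval_intervalIntegral_complex hg.1 hc)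
  have hfF : ∀ x ∈ Icc c d, f x = F x := hf.2
  have hgG : ∀ x ∈ Icc c d, g x = G x := hg.2
  have hFG : IsPrimitiveOn (fun x => F x * G x) (fun x => f' x * G x + F x * g' x) c d := by
    refine of_absolutelyContinuous (hF.fun_smul hG) ?_ ?_ hcd
    · exact (hf.1.mul_continuousOn hG.continuousOn).add (hg.1.continuousOn_mul hF.continuousOn)
    · filter_upwards [hf.1.ae_hasDerivAt_integral, hg.1.ae_hasDerivAt_integral] with x h₁ h₂ hx
      exact ((h₁ hx c hc).const_add (f c)).fun_mul ((h₂ hx c hc).const_add (g c))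
  have hmul := hFG.congr_ae (g' := fun x => f' x * g x + f x * g' x) hcd (ae_of_all _ fun x hx => by
    rw [hfF x ⟨hx.1.le, hx.2⟩, hgG x ⟨hx.1.le, hx.2⟩])
  refine ⟨hmul.1, fun x hx => ?_⟩
  simp only [hfF x hx, hgG x hx, hfF c (left_mem_Icc.2 hcd), hgG c (left_mem_Icc.2 hcd)]
  exact hmul.2 x hx

lemma star_dotProduct_mulVec {ι : Type*} [Fintype ι] {y y' : ℝ → ι → ℂ}
    (h : ∀ i, IsPrimitiveOn (fun x => y x i) (fun x => y' x i) c d) (hcd : c ≤ d)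
    (K : Matrix ι ι ℂ) :
    IsPrimitiveOn (fun x => Star.star (y x) ⬝ᵥ K *ᵥ y x)
      (fun x => Star.star (y' x) ⬝ᵥ K *ᵥ y x + Star.star (y x) ⬝ᵥ K *ᵥ y' x) c d := by
  have hK : ∀ i, IsPrimitiveOn (fun x => (K *ᵥ y x) i) (fun x => (K *ᵥ y' x) i) c d := fun i =>
    sum fun j _ => (h j).const_mul (K i j)
  have := sum (s := Finset.univ) fun i _ => (h i).star.mul (hK i) hcd
  simpa only [dotProduct, Pi.star_apply, Finset.sum_add_distrib] using this

end IsPrimitiveOn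

end Primitive

section Endpoint

variable {b : EReal} {c : ℝ}

lemma eventually_comap_nhdsLT {x : ℝ} (hx : (x : EReal) < b) :
    ∀ᶠ y in Filter.comap (fun y : ℝ => (y : EReal)) (𝓝[<] b), x < y ∧ (y : EReal) < b := by
  filter_upwards [preimage_mem_comap (Ioo_mem_nhdsLT hx)] with y hy
  exact ⟨EReal.coe_lt_coe_iff.1 hy.1, hy.2⟩

lemma neBot_comap_nhdsLT (hc : (c : EReal) < b) :
    (Filter.comap (fun y : ℝ => (y : EReal)) (𝓝[<] b)).NeBot := by
  refine comap_neBot fun t ht => ?_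
  obtain ⟨l, hl, hlt⟩ := (mem_nhdsLT_iff_exists_Ioo_subset' hc).1 ht
  obtain ⟨x, hx⟩ := EReal.lt_iff_exists_real_btwn.1 hl
  exact ⟨x, hlt hx⟩

lemma exists_tendsto_iff_bounded_of_monotone {f : ℝ → ℝ} (hc : (c : EReal) < b)
    (hf : ∀ x y, c ≤ x → x ≤ y → (y : EReal) < b → f x ≤ f y) :
    (∃ L, Tendsto f (Filter.comap (fun y : ℝ => (y : EReal)) (𝓝[<] b)) (𝓝 L)) ↔
      ∃ C, ∀ x, c ≤ x → (x : EReal) < b → f x ≤ C := by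
  constructor
  · rintro ⟨L, hL⟩
    have := neBot_comap_nhdsLT hc
    refine ⟨L, fun x hcx hxb => ge_of_tendsto hL ?_⟩
    filter_upwards [eventually_comap_nhdsLT hxb] with y hy
    exact hf x y hcx hy.1.le hy.2
  · rintro ⟨C, hC⟩
    have hlub := isLUB_csSup (s := f '' {x | c ≤ x ∧ (x : EReal) < b})
      ⟨f c, c, ⟨le_rfl, hc⟩, rfl⟩ ⟨C, by rintro _ ⟨x, hx, rfl⟩; exact hC x hx.1 hx.2⟩
    refine ⟨sSup (f '' {x | c ≤ x ∧ (x : EReal) < b}),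
      tendsto_order.2 ⟨fun l hl => ?_, fun u hu => ?_⟩⟩
    · obtain ⟨_, ⟨x, hx, rfl⟩, hlx⟩ := (lt_isLUB_iff hlub).1 hl
      filter_upwards [eventually_comap_nhdsLT hx.2] with y hy
      exact hlx.trans_le (hf x y hx.1 hy.1.le hy.2)
    · filter_upwards [eventually_comap_nhdsLT hc] with y hy
      exact (hlub.1 ⟨y, ⟨hy.1.le, hy.2⟩, rfl⟩).trans_lt hu

variable {q g : ℝ → ℂ} (hq : ∀ d : ℝ, c ≤ d → (d : EReal) < b → IsPrimitiveOn q g c d)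
  (hg : ∀ᵐ x : ℝ, c < x → (x : EReal) < b → 0 ≤ g x)
include hq hg

lemma IsPrimitiveOn.re_le_re {x y : ℝ} (hcx : c ≤ x) (hxy : x ≤ y) (hyb : (y : EReal) < b) :
    (q x).re ≤ (q y).re := by
  have hcy := hcx.trans hxy
  have hint := (hq y hcy hyb).1.mono_set (c := x) (d := y)
    (by rw [uIcc_of_le hxy, uIcc_of_le hcy]; exact Icc_subset_Icc_left hcx)
  have h := (hq y hcy hyb).sub_eq ⟨hcx, hxy⟩ ⟨hcy, le_rfl⟩
  have hre : (∫ t in x..y, g t).re = ∫ t in x..y, (g t).re :=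
    (Complex.reCLM.intervalIntegral_comp_comm hint).symm
  have hnn : 0 ≤ ∫ t in x..y, (g t).re := by
    refine intervalIntegral.integral_nonneg_of_ae_restrict hxy ?_
    rw [EventuallyLE, ae_restrict_iff' measurableSet_Icc]
    filter_upwards [hg, Measure.ae_ne volume c] with t ht htc htxy
    exact (Complex.le_def.1 (ht (lt_of_le_of_ne (hcx.trans htxy.1) htc.symm)
      (lt_of_le_of_lt (EReal.coe_le_coe_iff.2 htxy.2) hyb))).1
  rw [← hre, ← h, Complex.sub_re] at hnn
  linarith

lemma integrableOn_iff_re_bounded (hc : (c : EReal) < b) :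
    IntegrableOn g {x : ℝ | c < x ∧ (x : EReal) < b} ↔
      ∃ C, ∀ x, c ≤ x → (x : EReal) < b → (q x).re ≤ C := by
  set s : Set ℝ := {x : ℝ | c < x ∧ (x : EReal) < b} with hs
  have hsm : MeasurableSet s :=
    (measurableSet_lt measurable_const measurable_id).inter
      (measurableSet_lt measurable_coe_real_ereal measurable_const)
  have hsub : ∀ x : ℝ, (x : EReal) < b → Ioc c x ⊆ s := fun x hx t ht =>
    ⟨ht.1, lt_of_le_of_lt (EReal.coe_le_coe_iff.2 ht.2) hx⟩
  have hnorm : ∀ᵐ t ∂volume.restrict s, ‖g t‖ = (g t).re := by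
    rw [ae_restrict_iff' hsm]
    filter_upwards [hg] with t ht hts
    rw [← Complex.re_eq_norm.2 (ht hts.1 hts.2)]
  have hval : ∀ x, c ≤ x → (x : EReal) < b → ∫ t in Ioc c x, ‖g t‖ = (q x).re - (q c).re := by
    intro x hcx hxb
    have h := (hq x hcx hxb).sub_eq (left_mem_Icc.2 hcx) (right_mem_Icc.2 hcx)
    rw [integral_congr_ae (ae_restrict_of_ae_restrict_of_subset (hsub x hxb) hnorm),
      ← intervalIntegral.integral_of_le hcx, ← Complex.sub_re, h]
    exact Complex.reCLM.intervalIntegral_comp_comm (hq x hcx hxb).1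
  constructor
  · intro hint
    refine ⟨(q c).re + ∫ t in s, ‖g t‖, fun x hcx hxb => ?_⟩
    have h : ∫ t in Ioc c x, ‖g t‖ ≤ ∫ t in s, ‖g t‖ :=
      setIntegral_mono_set hint.norm (ae_of_all _ fun _ => norm_nonneg _)
        (hsub x hxb).eventuallyLE
    rw [hval x hcx hxb] at h
    linarith
  · rintro ⟨C, hC⟩
    have := neBot_comap_nhdsLT hc
    obtain ⟨u, -, hu, hub⟩ := exists_seq_strictMono_tendsto' hc
    have hcoe : ∀ n, (((u n).toReal : ℝ) : EReal) = u n := fun n =>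
      EReal.coe_toReal (hu n).2.ne_top (hu n).1.ne_bot
    have hcu : ∀ n, c ≤ (u n).toReal := fun n =>
      EReal.coe_le_coe_iff.1 (by rw [hcoe]; exact (hu n).1.le)
    have hub' : ∀ n, (((u n).toReal : ℝ) : EReal) < b := fun n => by rw [hcoe]; exact (hu n).2
    have hcover : AECover (volume.restrict s) atTop fun n => Iic (u n).toReal := by
      refine ⟨?_, fun n => measurableSet_Iic⟩
      filter_upwards [ae_restrict_mem hsm] with x hx
      filter_upwards [hub.eventually (lt_mem_nhds hx.2)] with n hn
      exact EReal.coe_le_coe_iff.1 (by rw [hcoe]; exact hn.le)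
    have hrestr : ∀ n, (volume.restrict s).restrict (Iic (u n).toReal) =
        volume.restrict (Ioc c (u n).toReal) := fun n => by
      rw [Measure.restrict_restrict measurableSet_Iic]
      congr 1
      ext x
      exact ⟨fun hx => ⟨hx.2.1, hx.1⟩, fun hx => ⟨hx.2, hsub _ (hub' n) hx⟩⟩
    refine hcover.integrable_of_integral_norm_bounded (C - (q c).re) (fun n => ?_)
      (Eventually.of_forall fun n => ?_)
    · rw [IntegrableOn, hrestr]
      exact (hq _ (hcu n) (hub' n)).1.1
    · rw [hrestr, hval _ (hcu n) (hub' n)]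
      linarith [hC _ (hcu n) (hub' n)]

end Endpoint

lemma conjTranspose_stdJ (n : ℕ) : (stdJ n)ᴴ = -stdJ n := by
  simp [stdJ, fromBlocks_conjTranspose, fromBlocks_neg]

lemma conjTranspose_stdJi (n : ℕ) : (stdJi n)ᴴ = stdJi n := by
  simp [stdJi, conjTranspose_smul, conjTranspose_stdJ]

lemma isHermitian_calA (n : ℕ) (lam : ℂ) (Φ : ℝ → Matrix (Fin n ⊕ Fin n) (Fin n ⊕ Fin n) ℂ)
    (x : ℝ) : (calA n lam Φ x).IsHermitian := by
  rw [IsHermitian, calA, conjTranspose_smul, conjTranspose_mul, conjTranspose_mul,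
    conjTranspose_stdJi, conjTranspose_conjTranspose, mul_assoc]
  simp

/-- The pointwise form of the Lagrange identity for the Hamiltonian system. -/
lemma lagrange_identity (n : ℕ) {lam : ℂ}
    {B₀ B₁ : Matrix (Fin n ⊕ Fin n) (Fin n ⊕ Fin n) ℂ} (h₀ : B₀.IsHermitian)
    (h₁ : B₁.IsHermitian) {y y' : Fin n ⊕ Fin n → ℂ}
    (hy : stdJ n *ᵥ y' = (B₀ + lam • B₁) *ᵥ y) :
    star y' ⬝ᵥ stdJi n *ᵥ y + star y ⬝ᵥ stdJi n *ᵥ y' =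
      2 * (lam.im : ℂ) * (star y ⬝ᵥ B₁ *ᵥ y) := by
  have h2 : star y' ⬝ᵥ stdJ n *ᵥ y = -(star y ⬝ᵥ (B₀ + star lam • B₁) *ᵥ y) := by
    have h3 : star y' ᵥ* stdJ n = -star (stdJ n *ᵥ y') := by
      rw [star_mulVec, conjTranspose_stdJ, vecMul_neg, neg_neg]
    rw [dotProduct_mulVec, h3, hy, star_mulVec, conjTranspose_add, conjTranspose_smul, h₀.eq, h₁.eq,
      neg_dotProduct, ← dotProduct_mulVec]
  have him : lam - star lam = 2 * (lam.im : ℂ) * Complex.I := by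
    rw [Complex.star_def, Complex.sub_conj]
    push_cast
    ring
  simp only [stdJi, smul_mulVec, dotProduct_smul, h2, hy, add_mulVec, dotProduct_add, smul_eq_mul]
  linear_combination (-Complex.I * (star y ⬝ᵥ B₁ *ᵥ y)) * him -
    (2 * (lam.im : ℂ) * (star y ⬝ᵥ B₁ *ᵥ y)) * Complex.I_mul_I

lemma star_dotProduct_calA_mulVec (n : ℕ) (lam : ℂ)
    (Φ : ℝ → Matrix (Fin n ⊕ Fin n) (Fin n ⊕ Fin n) ℂ) (x : ℝ) (v : Fin n ⊕ Fin n → ℂ) :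
    star v ⬝ᵥ calA n lam Φ x *ᵥ v =
      1 / (2 * (lam.im : ℂ)) * (star (Φ x *ᵥ v) ⬝ᵥ stdJi n *ᵥ (Φ x *ᵥ v)) := by
  rw [calA, smul_mulVec, dotProduct_smul, smul_eq_mul, star_mulVec, ← dotProduct_mulVec,
    mulVec_mulVec, mulVec_mulVec]

/-- Niessen's lemma: the dimension `m_b(λ)` of the space of solutions `Φ(·)w` lying right
in `(a,b)` equals the number of ordered eigenvalues `μ_j(x)` of `A(x;λ)` that converge to a
finite limit as `x → b⁻`. Here `μ x : Fin (2n) → ℝ` lists the eigenvalues of `A(x)` in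
nondecreasing order with multiplicity (encoded by the characteristic polynomial). -/
theorem niessen_dimension_count
    (n : ℕ) (hn : 1 ≤ n) (a b : EReal) (hab : a < b)
    (S : Set ℝ) (hS : S = {x : ℝ | a < (x : EReal) ∧ (x : EReal) < b})
    (c : ℝ) (hc : c ∈ S)
    (B0 B1 : ℝ → Matrix (Fin n ⊕ Fin n) (Fin n ⊕ Fin n) ℂ)
    (hBmeas : ∀ i j, Measurable (fun x => B0 x i j) ∧ Measurable (fun x => B1 x i j))
    (hBloc : ∀ i j, ∀ c' d' : ℝ, c' ∈ S → d' ∈ S →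
      IntegrableOn (fun x => B0 x i j) (Icc c' d') ∧
      IntegrableOn (fun x => B1 x i j) (Icc c' d'))
    (hherm : ∀ᵐ x ∂(volume.restrict S),
      (B0 x).IsHermitian ∧ (B1 x).IsHermitian ∧ (B1 x).PosSemidef)
    (lam : ℂ) (hlam : lam.im ≠ 0)
    (Φ DΦ : ℝ → Matrix (Fin n ⊕ Fin n) (Fin n ⊕ Fin n) ℂ)
    (hΦ'loc : ∀ i j, ∀ c' d' : ℝ, c' ∈ S → d' ∈ S →
      IntegrableOn (fun x => DΦ x i j) (Icc c' d'))
    (hΦAC : ∀ x ∈ S, ∀ i j, Φ x i j = Φ c i j + ∫ t in c..x, DΦ t i j)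
    (hODE : ∀ᵐ x ∂(volume.restrict S), stdJ n * DΦ x = (B0 x + lam • B1 x) * Φ x)
    (hΦc : Φ c = 1)
    (hΦinv : ∀ x ∈ S, IsUnit (Φ x))
    (hAtkinson : ∀ w : (Fin n ⊕ Fin n) → ℂ, w ≠ 0 →
      ∀ c' d' : ℝ, c' ∈ S → d' ∈ S → c' < d' →
        0 < (∫ x in c'..d',
          star ((Φ x).mulVec w) ⬝ᵥ (B1 x).mulVec ((Φ x).mulVec w)).re)
    (μ : ℝ → Fin (2 * n) → ℝ)
    (hμmono : ∀ x ∈ S, Monotone (μ x))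
    (hμchar : ∀ x ∈ S, (calA n lam Φ x).charpoly =
      ∏ j : Fin (2 * n), (Polynomial.X - Polynomial.C ((μ x j : ℝ) : ℂ))) :
    ∃ W : Submodule ℂ ((Fin n ⊕ Fin n) → ℂ),
      (W : Set ((Fin n ⊕ Fin n) → ℂ)) =
        {w | IntegrableOn
          (fun x => star ((Φ x).mulVec w) ⬝ᵥ (B1 x).mulVec ((Φ x).mulVec w))
          {x : ℝ | c < x ∧ (x : EReal) < b}} ∧
      Module.finrank ℂ W =
        Nat.card {j : Fin (2 * n) // ∃ L : ℝ,
          Tendsto (fun x => μ x j)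
            (Filter.comap (fun x : ℝ => (x : EReal)) (𝓝[<] b)) (𝓝 L)} := by
  have hcb : (c : EReal) < b := by
    rw [hS] at hc
    exact hc.2
  have hmem : ∀ x : ℝ, c ≤ x → (x : EReal) < b → x ∈ S := by
    intro x hcx hxb
    rw [hS] at hc ⊢
    exact ⟨hc.1.trans_le (EReal.coe_le_coe_iff.2 hcx), hxb⟩
  have hSm : MeasurableSet S := by
    rw [hS]
    exact (measurableSet_lt measurable_const measurable_coe_real_ereal).inter
      (measurableSet_lt measurable_coe_real_ereal measurable_const)
  rw [ae_restrict_iff' hSm] at hherm hODE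
  let g : (Fin n ⊕ Fin n → ℂ) → ℝ → ℂ := fun v x => star (Φ x *ᵥ v) ⬝ᵥ B1 x *ᵥ (Φ x *ᵥ v)
  have hprim : ∀ v, ∀ d : ℝ, c ≤ d → (d : EReal) < b →
      IsPrimitiveOn (fun x => star v ⬝ᵥ calA n lam Φ x *ᵥ v) (g v) c d := by
    intro v d hcd hdb
    have hΦ : ∀ i j, IsPrimitiveOn (fun x => Φ x i j) (fun x => DΦ x i j) c d := fun i j =>
      ⟨(intervalIntegrable_iff_integrableOn_Icc_of_le hcd).2
        (hΦ'loc i j c d hc (hmem d hcd hdb)), fun x hx =>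
        hΦAC x (hmem x hx.1 (lt_of_le_of_lt (EReal.coe_le_coe_iff.2 hx.2) hdb)) i j⟩
    have hy : ∀ i, IsPrimitiveOn (fun x => (Φ x *ᵥ v) i) (fun x => (DΦ x *ᵥ v) i) c d := by
      intro i
      have := IsPrimitiveOn.sum (s := Finset.univ) fun j _ => (hΦ i j).const_mul (v j)
      simpa only [mulVec, dotProduct, mul_comm] using this
    have h := ((IsPrimitiveOn.star_dotProduct_mulVec hy hcd (stdJi n)).const_mul
      (1 / (2 * (lam.im : ℂ)))).congr_ae (g' := g v) hcd (by
        filter_upwards [hherm, hODE] with x h1 h2 hx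
        have hxS := hmem x hx.1.le (lt_of_le_of_lt (EReal.coe_le_coe_iff.2 hx.2) hdb)
        have hode : stdJ n *ᵥ (DΦ x *ᵥ v) = (B0 x + lam • B1 x) *ᵥ (Φ x *ᵥ v) := by
          rw [mulVec_mulVec, mulVec_mulVec, h2 hxS]
        rw [lagrange_identity n (h1 hxS).1 (h1 hxS).2.1 hode]
        have : (lam.im : ℂ) ≠ 0 := Complex.ofReal_ne_zero.2 hlam
        field_simp
        rfl)
    simpa only [star_dotProduct_calA_mulVec] using h
  have hnonneg : ∀ v, ∀ᵐ x : ℝ, c < x → (x : EReal) < b → 0 ≤ g v x := by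
    intro v
    filter_upwards [hherm] with x h1 hcx hxb
    exact (h1 (hmem x hcx.le hxb)).2.2.dotProduct_mulVec_nonneg _
  let τ := {x : ℝ // c ≤ x ∧ (x : EReal) < b}
  let _ : OrderBot τ := { bot := ⟨c, le_rfl, hcb⟩, bot_le := fun x => x.2.1 }
  have hτ : ∀ x : τ, (x : ℝ) ∈ S := fun x => hmem x x.2.1 x.2.2
  have hmonoA : ∀ v, Monotone fun x : τ => reForm (calA n lam Φ x) v := fun v x y hxy =>
    IsPrimitiveOn.re_le_re (hprim v) (hnonneg v) x.2.1 hxy y.2.2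
  have hhermA : ∀ x : τ, (calA n lam Φ x).IsHermitian := fun x => isHermitian_calA n lam Φ x
  have hcharA := fun x : τ => hμchar x (hτ x)
  have hmonoμ := fun x : τ => hμmono x (hτ x)
  refine ⟨boundedSubspace (fun x : τ => calA n lam Φ x) hmonoA, ?_, ?_⟩
  · ext v
    refine Iff.trans ?_ (integrableOn_iff_re_bounded (hprim v) (hnonneg v) hcb).symm
    exact exists_congr fun C => ⟨fun h x hcx hxb => h ⟨x, hcx, hxb⟩, fun h x => h x x.2.1 x.2.2⟩
  · rw [← card_bounded_eigenvalues hmonoA hhermA hcharA hmonoμ (by simp [two_mul])]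
    refine Nat.card_congr (Equiv.subtypeEquivRight fun j => ?_)
    have hj := monotone_eigenvalue hmonoA hhermA hcharA hmonoμ j
    rw [exists_tendsto_iff_bounded_of_monotone (f := fun x => μ x j) hcb fun x y hcx hxy hyb =>
      hj (a := ⟨x, hcx, lt_of_le_of_lt (EReal.coe_le_coe_iff.2 hxy) hyb⟩)
        (b := ⟨y, hcx.trans hxy, hyb⟩) hxy]
    exact exists_congr fun C => ⟨fun h x hcx hxb => h ⟨x, hcx, hxb⟩, fun h x => h x x.2.1 x.2.2⟩
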